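/- Let (V,d) be a finite metric space and t > 0. Let (V', d') be the metric space with V' = V ∪ {⋆} (⋆ a new point), d'(u,v) = min{d(u,v), t} for u,v ∈ V, and d'(v,⋆) = d'(⋆,v) = t/2 for v ∈ V. Suppose there exists a map g : V' → ℓ1 with g(⋆) = 0 such that d'(x,y) ≤ ‖g(x) − g(y)‖₁ ≤ 2·d'(x,y) for all x,y ∈ V'. Then there exists f : V → ℓ1 such that: (1) ‖f(v)‖₁ = t for every v ∈ V; (2) ‖f(v) − f(u)‖₁ ≤ 4·d(v,u) for all u,v ∈ V; and (3) ‖f(v) − f(u)‖₁ ≥ min{d(v,u), t} for all u,v ∈ V. -/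

import Mathlib

noncomputable section

/-- The space `ℓ₁` of absolutely summable real sequences. -/
abbrev ℓ1 : Type := lp (fun _ : ℕ => ℝ) 1

/-- The `t`-truncation of the metric of `V`, augmented by an apex point `none`
at distance `t/2` from every point of `V`. -/
def apexDist {V : Type*} [MetricSpace V] (t : ℝ) : Option V → Option V → ℝ
  | some u, some v => min (dist u v) t
  | some _, none => t / 2
  | none, some _ => t / 2
  | none, none => 0

def consSeq (c : ℝ) (x : ℕ → ℝ) : ℕ → ℝ
  | 0 => c
  | k + 1 => x k

theorem memlp_cons (c : ℝ) (x : ℓ1) :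
    Memℓp (E := fun _ : ℕ => ℝ) (consSeq c (fun k => x k)) 1 := by
  have hx := lp.memℓp x
  rw [memℓp_gen_iff (by norm_num)] at hx ⊢
  rw [← summable_nat_add_iff 1]
  exact hx

def consL1 (c : ℝ) (x : ℓ1) : ℓ1 :=
  ⟨(consSeq c (fun k => x k) : PreLp (fun _ : ℕ => ℝ)), memlp_cons c x⟩

theorem norm_consL1 (c : ℝ) (x : ℓ1) : ‖consL1 c x‖ = |c| + ‖x‖ := by
  have h1 : ∀ y : ℓ1, ‖y‖ = ∑' n, ‖y n‖ := fun y => by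
    rw [lp.norm_eq_tsum_rpow (by norm_num)]; simp
  have hs : Summable fun n => ‖consL1 c x n‖ := by
    have hx := lp.memℓp (consL1 c x)
    rw [memℓp_gen_iff (by norm_num)] at hx
    simpa using hx
  rw [h1, h1, hs.tsum_eq_zero_add]
  rfl

theorem consL1_sub (c d : ℝ) (x y : ℓ1) :
    consL1 c x - consL1 d y = consL1 (c - d) (x - y) := by
  apply lp.ext
  funext n
  cases n <;> rfl

/-- Let `(V,d)` be a finite metric space and `t > 0`, and let `d'` be the `t`-truncated
metric on `V ∪ {⋆}` with apex `⋆` at distance `t/2` from every point.  If there is a map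
`g : V ∪ {⋆} → ℓ₁` with `g ⋆ = 0` and `d'(x,y) ≤ ‖g x - g y‖ ≤ 2·d'(x,y)` for all `x, y`,
then there is `f : V → ℓ₁` with `‖f v‖ = t` for all `v`, which is `4`-Lipschitz and
satisfies `‖f v - f u‖ ≥ min {d(v,u), t}`. -/
theorem truncated_from_apex (V : Type) [Fintype V] [MetricSpace V] (t : ℝ) (ht : 0 < t)
    (g : Option V → ℓ1) (hg0 : g none = 0)
    (hg : ∀ x y : Option V,
      apexDist t x y ≤ ‖g x - g y‖ ∧ ‖g x - g y‖ ≤ 2 * apexDist t x y) :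
    ∃ f : V → ℓ1,
      (∀ v : V, ‖f v‖ = t) ∧
      (∀ u v : V, ‖f v - f u‖ ≤ 4 * dist v u) ∧
      (∀ u v : V, min (dist v u) t ≤ ‖f v - f u‖) := by
  have hn : ∀ v : V, ‖g (some v)‖ ≤ t := fun v => by
    have h := (hg (some v) none).2
    rw [hg0, sub_zero] at h
    simp only [apexDist] at h
    linarith
  refine ⟨fun v => consL1 (t - ‖g (some v)‖) (g (some v)), fun v => ?_, fun u v => ?_,
    fun u v => ?_⟩
  · rw [norm_consL1, abs_of_nonneg (by linarith [hn v])]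
    ring
  · rw [consL1_sub, norm_consL1]
    have h := (hg (some v) (some u)).2
    simp only [apexDist] at h
    have h2 := abs_norm_sub_norm_le (g (some u)) (g (some v))
    rw [norm_sub_rev] at h2
    have h3 := min_le_left (dist v u) t
    have e : t - ‖g (some v)‖ - (t - ‖g (some u)‖) = ‖g (some u)‖ - ‖g (some v)‖ := by ring
    rw [e]
    linarith
  · rw [consL1_sub, norm_consL1]
    have h := (hg (some v) (some u)).1
    simp only [apexDist] at h
    exact h.trans (le_add_of_nonneg_left (abs_nonneg _))
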